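/- arXiv:1805.11992 — 3 statements merged into one kernel-verified Lean document; each statement's English description precedes it below -/
import Mathlib

section
/- Let M be a nonempty compact metric space, f : M → M a homeomorphism, (F, d) a nonempty complete metric space, λ ∈ [0,1), and g : M × F → F a continuous map satisfying d(g(x,y), g(x,y')) ≤ λ · d(y, y') for all x ∈ M and y, y' ∈ F. Then there exists a unique continuous map ι : M → F such that g(x, ι(x)) = ι(f(x)) for every x ∈ M. -/
/-- The graph transform of `(x, y) ↦ (f x, g (x, y))`: it sends a continuous section `ι` to the
section whose graph is the image of the graph of `ι`. -/
def graphTransform {M F : Type*} [TopologicalSpace M] [TopologicalSpace F]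
    (f : M ≃ₜ M) (g : C(M × F, F)) (ι : C(M, F)) : C(M, F) where
  toFun x := g (f.symm x, ι (f.symm x))
  continuous_toFun := by fun_prop

theorem isFixedPt_graphTransform_iff {M F : Type*} [TopologicalSpace M] [TopologicalSpace F]
    (f : M ≃ₜ M) (g : C(M × F, F)) (ι : C(M, F)) :
    Function.IsFixedPt (graphTransform f g) ι ↔ ∀ x, g (x, ι x) = ι (f x) := by
  refine ⟨fun h x => ?_, fun h => ContinuousMap.ext fun x => ?_⟩
  · simpa [graphTransform] using DFunLike.congr_fun h (f x)
  · simpa [graphTransform] using h (f.symm x)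

theorem contractingWith_graphTransform {M F : Type*} [TopologicalSpace M] [CompactSpace M]
    [MetricSpace F] (f : M ≃ₜ M) (g : C(M × F, F)) {K : NNReal} (hK : K < 1)
    (hg : ∀ x, LipschitzWith K fun y => g (x, y)) :
    ContractingWith K (graphTransform f g) := by
  refine ⟨hK, LipschitzWith.of_dist_le_mul fun ι κ => ?_⟩
  refine (ContinuousMap.dist_le (by positivity)).2 fun x => ?_
  exact ((hg _).dist_le_mul _ _).trans
    (mul_le_mul_of_nonneg_left (ContinuousMap.dist_apply_le_dist _) K.coe_nonneg)

/-- Invariant section theorem: if `f : M → M` is a homeomorphism of a nonempty compact metric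
space, `F` a nonempty complete metric space, and `g : M × F → F` a continuous map which is a
uniform `λ`-contraction (`λ < 1`) in the fiber variable, then there is a unique continuous
map `ι : M → F` with `g(x, ι(x)) = ι(f(x))` for all `x`. -/
theorem exists_unique_invariant_section
    (M : Type*) [MetricSpace M] [CompactSpace M] [Nonempty M] (f : M ≃ₜ M)
    (F : Type*) [MetricSpace F] [CompleteSpace F] [Nonempty F]
    (lam : ℝ) (hlam0 : 0 ≤ lam) (hlam1 : lam < 1)
    (g : M × F → F) (hg : Continuous g)
    (hcontr : ∀ (x : M) (y y' : F), dist (g (x, y)) (g (x, y')) ≤ lam * dist y y') :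
    ∃! ι : M → F, Continuous ι ∧ ∀ x : M, g (x, ι x) = ι (f x) := by
  lift lam to NNReal using hlam0
  have hT := contractingWith_graphTransform f ⟨g, hg⟩ (K := lam) (by exact_mod_cast hlam1)
    fun x => LipschitzWith.of_dist_le_mul (hcontr x)
  obtain ⟨y₀⟩ := ‹Nonempty F›
  have : Nonempty C(M, F) := ⟨ContinuousMap.const M y₀⟩
  refine ⟨hT.fixedPoint, ⟨map_continuous _,
    (isFixedPt_graphTransform_iff f ⟨g, hg⟩ _).1 hT.fixedPoint_isFixedPt⟩, ?_⟩
  rintro κ ⟨hκ, hinv⟩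
  exact congrArg DFunLike.coe <|
    hT.fixedPoint_unique ((isFixedPt_graphTransform_iff f ⟨g, hg⟩ ⟨κ, hκ⟩).2 hinv)
end

section
/- Let M be a nonempty compact metric space, f : M → M a homeomorphism, (F, d) a nonempty bounded complete metric space, λ ∈ [0,1), and g : M × F → F a continuous map satisfying d(g(x,y), g(x,y')) ≤ λ · d(y, y') for all x ∈ M and y, y' ∈ F. Let ι : M → F be the unique continuous map with g(x, ι(x)) = ι(f(x)) for all x, and define F̂ : M × F → M × F by F̂(x,y) = (f(x), g(x,y)). Then ⋂_{n ∈ ℕ} F̂^n(M × F) = { (x, ι(x)) : x ∈ M }, i.e. the intersection of all forward images equals the graph of the invariant section. -/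
/-- Under a skew product whose fiber maps contract by `lam`, the vertical distance to an
invariant section decays like `lam ^ n`. -/
theorem dist_skewProduct_iterate_section_le {M F : Type*} [PseudoMetricSpace F]
    (f : M → M) {lam : ℝ} (hlam0 : 0 ≤ lam) (g : M × F → F)
    (hcontr : ∀ (x : M) (y y' : F), dist (g (x, y)) (g (x, y')) ≤ lam * dist y y')
    (ι : M → F) (hι_inv : ∀ x : M, g (x, ι x) = ι (f x)) (n : ℕ) (p : M × F) :
    dist ((fun p : M × F => (f p.1, g p))^[n] p).2
      (ι ((fun p : M × F => (f p.1, g p))^[n] p).1) ≤ lam ^ n * dist p.2 (ι p.1) := by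
  induction n with
  | zero => simp
  | succ n ih =>
    rw [Function.iterate_succ_apply', ← hι_inv, pow_succ', mul_assoc]
    exact (hcontr _ _ _).trans (mul_le_mul_of_nonneg_left ih hlam0)

/-- The graph map of an invariant section semiconjugates the base map to the skew product. -/
theorem semiconj_graph_skewProduct {M F : Type*} (f : M → M) (g : M × F → F)
    (ι : M → F) (hι_inv : ∀ x : M, g (x, ι x) = ι (f x)) :
    Function.Semiconj (fun x => (x, ι x)) f (fun p : M × F => (f p.1, g p)) :=
  fun x => by simp [hι_inv]

/-- For a fiber-contracting extension `F̂(x,y) = (f(x), g(x,y))` over a homeomorphism `f` of a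
compact metric space, with fibers a nonempty bounded complete metric space, the intersection
of all forward images `F̂ⁿ(M × F)` equals the graph of the invariant section `ι`. -/
theorem iInter_image_iterate_eq_graph_invariant_section
    (M : Type*) [MetricSpace M] [CompactSpace M] [Nonempty M] (f : M ≃ₜ M)
    (F : Type*) [MetricSpace F] [CompleteSpace F] [Nonempty F]
    (hbdd : Bornology.IsBounded (Set.univ : Set F))
    (lam : ℝ) (hlam0 : 0 ≤ lam) (hlam1 : lam < 1)
    (g : M × F → F) (hg : Continuous g)
    (hcontr : ∀ (x : M) (y y' : F), dist (g (x, y)) (g (x, y')) ≤ lam * dist y y')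
    (ι : M → F) (hι_cont : Continuous ι) (hι_inv : ∀ x : M, g (x, ι x) = ι (f x)) :
    ⋂ n : ℕ, (fun p : M × F => (f p.1, g p))^[n] '' Set.univ =
      Set.range (fun x : M => (x, ι x)) := by
  apply Set.Subset.antisymm
  · rintro ⟨x, y⟩ hxy
    obtain ⟨C, hC⟩ := Metric.isBounded_iff.1 hbdd
    have hle : ∀ n : ℕ, dist y (ι x) ≤ lam ^ n * C := by
      intro n
      obtain ⟨p, -, hp⟩ := Set.mem_iInter.1 hxy n
      have h := dist_skewProduct_iterate_section_le f hlam0 g hcontr ι hι_inv n p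
      rw [hp] at h
      exact h.trans (mul_le_mul_of_nonneg_left (hC (Set.mem_univ _) (Set.mem_univ _))
        (pow_nonneg hlam0 n))
    have hlim : Filter.Tendsto (fun n : ℕ => lam ^ n * C) Filter.atTop (nhds 0) := by
      simpa using (tendsto_pow_atTop_nhds_zero_of_lt_one hlam0 hlam1).mul_const C
    have hy : y = ι x := dist_le_zero.1 (ge_of_tendsto' hlim hle)
    exact ⟨x, by rw [hy]⟩
  · rintro _ ⟨x, rfl⟩
    refine Set.mem_iInter.2 fun n => ?_
    obtain ⟨z, rfl⟩ := f.surjective.iterate n x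
    exact ⟨(z, ι z), Set.mem_univ _,
      (((semiconj_graph_skewProduct f g ι hι_inv).iterate_right n) z).symm⟩
end

section
/- With the spaces Ω_{ν,q} and the operators D_ν, D*_ν defined as in the context, for all 0 ≤ ν ≤ d and q ≥ 0 one has the homotopy identity D*_{ν+1} ∘ D_ν + D_{ν−1} ∘ D*_ν = −(q + d − ν) · Id as linear maps Ω_{ν,q} → Ω_{ν,q} (with the convention that D_ν, D*_ν and the out-of-range spaces are zero when the indices leave the range 0 ≤ ν ≤ d, q ≥ 0). -/
/-- Index type: pairs `(α, I)` of a multi-index `α : Fin d → ℕ` and a subset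
`I ⊆ {1,…,d}`, indexing the currents `δ^{(α)} dy_I` on `ℝ^d`. -/
abbrev DeltaIdx (d : ℕ) := (Fin d → ℕ) × Finset (Fin d)

/-- The space of finitely supported formal `ℝ`-linear combinations of the symbols
`δ^{(α)} dy_I`. -/
abbrev DeltaSpace (d : ℕ) := DeltaIdx d →₀ ℝ

/-- `♯(I,i)`: the number of elements of `I` strictly smaller than `i`. -/
def sharp {d : ℕ} (I : Finset (Fin d)) (i : Fin d) : ℕ :=
  (I.filter (fun j => j < i)).card

/-- The graded piece `Ω_{ν,q}`: formal combinations of `δ^{(α)} dy_I` with `|α| = q` and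
`|I| = ν`. -/
noncomputable def OmegaGrade (d ν q : ℕ) : Submodule ℝ (DeltaSpace d) :=
  Finsupp.supported ℝ ℝ {p : DeltaIdx d | (∑ i, p.1 i) = q ∧ p.2.card = ν}

/-- The exterior derivative on currents:
`D (δ^{(α)} dy_I) = ∑_{i ∉ I} (−1)^{♯(I,i)} δ^{(α+δ_i)} dy_{I ∪ {i}}`. -/
noncomputable def derD (d : ℕ) : DeltaSpace d →ₗ[ℝ] DeltaSpace d :=
  Finsupp.lsum ℝ (fun p : DeltaIdx d => LinearMap.toSpanSingleton ℝ (DeltaSpace d)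
    (∑ i ∈ p.2ᶜ, ((-1 : ℝ) ^ sharp p.2 i) •
      Finsupp.single (p.1 + Pi.single i 1, insert i p.2) (1 : ℝ)))

/-- The formal adjoint of the exterior derivative:
`D* (δ^{(α)} dy_I) = ∑_{i ∈ I} (−1)^{♯(I,i)−1} α(i) · δ^{(α−δ_i)} dy_{I ∖ {i}}`
(terms with `α(i) = 0` vanish). -/
noncomputable def derDstar (d : ℕ) : DeltaSpace d →ₗ[ℝ] DeltaSpace d :=
  Finsupp.lsum ℝ (fun p : DeltaIdx d => LinearMap.toSpanSingleton ℝ (DeltaSpace d)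
    (∑ i ∈ p.2, (((-1 : ℝ) ^ ((sharp p.2 i : ℤ) - 1)) * (p.1 i : ℝ)) •
      Finsupp.single (p.1 - Pi.single i 1, p.2.erase i) (1 : ℝ)))

theorem derD_single {d : ℕ} (α : Fin d → ℕ) (I : Finset (Fin d)) :
    derD d (Finsupp.single (α, I) 1) =
      ∑ i ∈ Iᶜ, ((-1 : ℝ) ^ sharp I i) •
        Finsupp.single (α + Pi.single i 1, insert i I) (1 : ℝ) := by
  simp [derD]

theorem derDstar_single {d : ℕ} (α : Fin d → ℕ) (I : Finset (Fin d)) :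
    derDstar d (Finsupp.single (α, I) 1) =
      ∑ i ∈ I, (-((-1 : ℝ) ^ sharp I i * (α i : ℝ))) •
        Finsupp.single (α - Pi.single i 1, I.erase i) (1 : ℝ) := by
  have h (i : Fin d) : (-1 : ℝ) ^ ((sharp I i : ℤ) - 1) = -(-1 : ℝ) ^ sharp I i := by
    rw [zpow_sub₀ (by norm_num), zpow_natCast, zpow_one, div_neg, div_one]
  rw [derDstar, Finsupp.lsum_single, LinearMap.toSpanSingleton_apply, one_smul]
  simp only [h, neg_mul]

theorem sharp_insert_self {d : ℕ} (I : Finset (Fin d)) (i : Fin d) :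
    sharp (insert i I) i = sharp I i := by
  simp [sharp, Finset.filter_insert]

theorem sharp_erase_self {d : ℕ} (I : Finset (Fin d)) (i : Fin d) :
    sharp (I.erase i) i = sharp I i := by
  simp [sharp, Finset.filter_erase]

/-- Inserting `i` and erasing `j` anticommute at the level of signs. -/
theorem neg_one_pow_sharp_insert_erase {d : ℕ} {I : Finset (Fin d)} {i j : Fin d}
    (hi : i ∉ I) (hj : j ∈ I) :
    (-1 : ℝ) ^ sharp I i * (-1) ^ sharp (insert i I) j =
      -((-1) ^ sharp I j * (-1) ^ sharp (I.erase j) i) := by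
  have hij : i ≠ j := fun h => hi (h ▸ hj)
  rcases lt_or_gt_of_ne hij with h | h
  · have h1 : sharp (insert i I) j = sharp I j + 1 := by
      simp [sharp, Finset.filter_insert, h, hi]
    have h2 : sharp (I.erase j) i = sharp I i := by
      simp [sharp, Finset.filter_erase, h.le]
    rw [h1, h2]
    ring
  · have h1 : sharp (insert i I) j = sharp I j := by
      simp [sharp, Finset.filter_insert, h.not_gt]
    have h2 : sharp I i = sharp (I.erase j) i + 1 := by
      rw [sharp, sharp, Finset.filter_erase, Finset.card_erase_add_one (by simp [hj, h])]
    rw [h1, h2]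
    ring

theorem derDstar_derD_single {d : ℕ} (α : Fin d → ℕ) (I : Finset (Fin d)) :
    derDstar d (derD d (Finsupp.single (α, I) 1)) =
      (-∑ i ∈ Iᶜ, ((α i : ℝ) + 1)) • Finsupp.single (α, I) 1 +
      ∑ i ∈ Iᶜ, ∑ j ∈ I, (-((-1 : ℝ) ^ sharp I i * (-1) ^ sharp (insert i I) j * (α j : ℝ))) •
        Finsupp.single (α + Pi.single i 1 - Pi.single j 1, (insert i I).erase j) (1 : ℝ) := by
  simp only [derD_single, map_sum, map_smul, derDstar_single]
  rw [← Finset.sum_neg_distrib, Finset.sum_smul, ← Finset.sum_add_distrib]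
  refine Finset.sum_congr rfl fun i hi => ?_
  rw [Finset.mem_compl] at hi
  rw [Finset.sum_insert hi, smul_add, Finset.smul_sum]
  congr 1
  · rw [smul_smul, sharp_insert_self, add_tsub_cancel_right, Finset.erase_insert hi]
    congr 1
    rw [mul_neg, ← mul_assoc, ← mul_pow]
    simp
  · refine Finset.sum_congr rfl fun j hj => ?_
    have hij : j ≠ i := fun h => hi (h ▸ hj)
    rw [smul_smul]
    congr 1
    simp [hij, mul_assoc]

theorem derD_derDstar_single {d : ℕ} (α : Fin d → ℕ) (I : Finset (Fin d)) :
    derD d (derDstar d (Finsupp.single (α, I) 1)) =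
      (-∑ j ∈ I, (α j : ℝ)) • Finsupp.single (α, I) 1 +
      ∑ j ∈ I, ∑ i ∈ Iᶜ, (-((-1 : ℝ) ^ sharp I j * (-1) ^ sharp (I.erase j) i * (α j : ℝ))) •
        Finsupp.single (α - Pi.single j 1 + Pi.single i 1, insert i (I.erase j)) (1 : ℝ) := by
  simp only [derDstar_single, map_sum, map_smul, derD_single]
  rw [← Finset.sum_neg_distrib, Finset.sum_smul, ← Finset.sum_add_distrib]
  refine Finset.sum_congr rfl fun j hj => ?_
  rw [Finset.compl_erase, Finset.sum_insert (by simpa using hj), smul_add, Finset.smul_sum]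
  congr 1
  · rw [smul_smul, sharp_erase_self, Finset.insert_erase hj]
    rcases Nat.eq_zero_or_pos (α j) with h | h
    · simp [h]
    · have hle : Pi.single j 1 ≤ α := by
        intro k
        by_cases hk : k = j
        · subst hk; simpa [Nat.one_le_iff_ne_zero] using h.ne'
        · simp [hk]
      rw [tsub_add_cancel_of_le hle]
      congr 1
      rw [neg_mul, mul_right_comm, ← mul_pow]
      simp
  · refine Finset.sum_congr rfl fun i _ => ?_
    rw [smul_smul]
    congr 1
    ring

theorem derDstar_derD_add_derD_derDstar_single {d : ℕ} (α : Fin d → ℕ) (I : Finset (Fin d)) :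
    derDstar d (derD d (Finsupp.single (α, I) 1)) +
        derD d (derDstar d (Finsupp.single (α, I) 1)) =
      (-(((∑ i, α i) + (d - I.card) : ℕ) : ℝ)) • Finsupp.single (α, I) (1 : ℝ) := by
  rw [derDstar_derD_single, derD_derDstar_single, add_add_add_comm, ← add_smul,
    Finset.sum_comm (s := I), ← Finset.sum_add_distrib]
  refine (congrArg₂ (· + ·) ?_ (Finset.sum_eq_zero ?_)).trans (add_zero _)
  · congr 1
    have hc : ((Iᶜ.card : ℕ) : ℝ) = ((d - I.card : ℕ) : ℝ) := by
      rw [Finset.card_compl, Fintype.card_fin]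
    rw [Nat.cast_add, ← hc, Nat.cast_sum, ← Finset.sum_add_sum_compl I, Finset.sum_add_distrib]
    simp only [Finset.sum_const, nsmul_eq_mul, mul_one]
    ring
  · intro i hi
    rw [Finset.mem_compl] at hi
    rw [← Finset.sum_add_distrib]
    refine Finset.sum_eq_zero fun j hj => ?_
    have hij : i ≠ j := fun h => hi (h ▸ hj)
    have hα : α + Pi.single i 1 - Pi.single j 1 = α - Pi.single j 1 + Pi.single i 1 := by
      funext k
      by_cases hk : k = i
      · subst hk; simp [hij]
      · simp [hk]
    rw [hα, Finset.erase_insert_of_ne hij, ← add_smul, neg_one_pow_sharp_insert_erase hi hj]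
    simp

/-- The homotopy identity `D*_{ν+1} ∘ D_ν + D_{ν−1} ∘ D*_ν = −(q + d − ν) · Id`
on the graded piece `Ω_{ν,q}`, for `0 ≤ ν ≤ d` and `q ≥ 0`. -/
theorem derDstar_derD_add_derD_derDstar (d ν q : ℕ) (hν : ν ≤ d) :
    ∀ u ∈ OmegaGrade d ν q,
      derDstar d (derD d u) + derD d (derDstar d u) =
        -(((q + (d - ν) : ℕ)) : ℝ) • u := by
  intro u hu
  rw [OmegaGrade, Finsupp.supported_eq_span_single] at hu
  induction hu using Submodule.span_induction with
  | mem x hx =>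
    obtain ⟨⟨α, I⟩, ⟨rfl, rfl⟩, rfl⟩ := hx
    exact derDstar_derD_add_derD_derDstar_single α I
  | zero => simp
  | add x y _ _ hx hy =>
    simp only [map_add, smul_add, ← hx, ← hy]
    abel
  | smul a x _ hx =>
    simp only [map_smul]
    rw [← smul_add, hx, smul_comm]
end
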